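/- Cycle-stationarity of the Palm distribution: let 𝔓 be a stationary simple point process on ℝ with intensity I ∈ (0,∞) and Palm distribution Q. Then for every j ≥ 1, Q-almost surely τ_j(η) < ∞, and the pushforward of Q under the map η ↦ θ^{τ_j(η)} η equals Q. -/

import Mathlib

open MeasureTheory Set Filter
open scoped ENNReal

/-- The shift `θ^u` on Borel measures on `ℝ`: `(θ^u ζ)(B) = ζ(B + u)`. -/
noncomputable def shift (u : ℝ) (ζ : Measure ℝ) : Measure ℝ :=
  Measure.map (fun t => t - u) ζ

/-- `𝔓` is stationary: the pushforward of `𝔓` under `θ^u` equals `𝔓` for every `u ∈ ℝ`. -/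
def IsStationaryPP (P : Measure (Measure ℝ)) : Prop :=
  ∀ u : ℝ, Measure.map (shift u) P = P

/-- `𝔓` is a simple point process: `𝔓`-a.e. `ζ` is `ℕ`-valued on bounded Borel sets and has
no multiple points. -/
def IsSimplePP (P : Measure (Measure ℝ)) : Prop :=
  ∀ᵐ ζ ∂P, (∀ B : Set ℝ, Bornology.IsBounded B → MeasurableSet B → ∃ n : ℕ, ζ B = (n : ℝ≥0∞)) ∧
    ∀ t : ℝ, ζ ({t} : Set ℝ) ≤ 1

/-- The intensity `I = ∫ ζ((0,1]) d𝔓(ζ)` of a stationary point process. -/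
noncomputable def intensity (P : Measure (Measure ℝ)) : ℝ≥0∞ :=
  ∫⁻ ζ, ζ (Set.Ioc (0 : ℝ) 1) ∂P

/-- `Q` is the Palm distribution of `𝔓`:
`∫ f dQ = I⁻¹ ∫ (∫_{(0,1]} f(θ^u ζ) ζ(du)) d𝔓(ζ)` for all measurable `f : M(ℝ) → [0,∞]`. -/
def IsPalm (P Q : Measure (Measure ℝ)) : Prop :=
  ∀ f : Measure ℝ → ℝ≥0∞, Measurable f →
    ∫⁻ η, f η ∂Q = (intensity P)⁻¹ * ∫⁻ ζ, (∫⁻ u in Set.Ioc (0 : ℝ) 1, f (shift u ζ) ∂ζ) ∂P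

/-- `τ_j(ζ) = inf {t > 0 : ζ((0,t]) ≥ j} ∈ (0,∞]` for `j ≥ 1` (with `inf ∅ = ∞`),
and `τ_0(ζ) = 0`. -/
noncomputable def tau (j : ℕ) (ζ : Measure ℝ) : ℝ≥0∞ :=
  if j = 0 then 0
  else sInf ((fun s : ℝ => ENNReal.ofReal s) '' {s : ℝ | 0 < s ∧ (j : ℝ≥0∞) ≤ ζ (Set.Ioc 0 s)})


open ProbabilityTheory
lemma shift_apply (u : ℝ) (ζ : Measure ℝ) {B : Set ℝ} (hB : MeasurableSet B) :
    shift u ζ B = ζ ((fun t => t - u) ⁻¹' B) := by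
  unfold shift
  rw [Measure.map_apply (by fun_prop) hB]

lemma shift_Ioc (u a b : ℝ) (ζ : Measure ℝ) :
    shift u ζ (Ioc a b) = ζ (Ioc (a + u) (b + u)) := by
  rw [shift_apply u ζ measurableSet_Ioc]
  congr 1; ext t; simp only [mem_preimage, mem_Ioc]; constructor <;> rintro ⟨h1, h2⟩ <;> constructor <;> linarith

lemma shift_Ioi (u a : ℝ) (ζ : Measure ℝ) :
    shift u ζ (Ioi a) = ζ (Ioi (a + u)) := by
  rw [shift_apply u ζ measurableSet_Ioi]
  congr 1; ext t; simp only [mem_preimage, mem_Ioi]; constructor <;> intro h <;> linarith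

lemma shift_shift (u w : ℝ) (ζ : Measure ℝ) : shift u (shift w ζ) = shift (u + w) ζ := by
  unfold shift
  rw [Measure.map_map (by fun_prop) (by fun_prop)]
  congr 1; ext t; simp; ring

lemma measurable_shift (u : ℝ) : Measurable (shift u) :=
  Measure.measurable_map _ (by fun_prop)

lemma lintegral_shift (u : ℝ) (ζ : Measure ℝ) (g : ℝ → ℝ≥0∞) (hg : Measurable g) {B : Set ℝ}
    (hB : MeasurableSet B) :
    ∫⁻ t in B, g t ∂(shift u ζ) = ∫⁻ t in (fun t => t - u) ⁻¹' B, g (t - u) ∂ζ := by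
  unfold shift
  rw [setLIntegral_map hB hg (by fun_prop)]

def GoodPP (ζ : Measure ℝ) : Prop :=
  (∀ B : Set ℝ, Bornology.IsBounded B → MeasurableSet B → ∃ n : ℕ, ζ B = (n : ℝ≥0∞)) ∧
    ∀ t : ℝ, ζ ({t} : Set ℝ) ≤ 1

lemma GoodPP.shift {ζ : Measure ℝ} (h : GoodPP ζ) (u : ℝ) : GoodPP (shift u ζ) := by
  constructor
  · intro B hB hm
    rw [shift_apply u ζ hm]
    apply h.1 _ _ (hm.preimage (by fun_prop))
    have : (fun t => t - u) ⁻¹' B = (fun t => t + u) '' B := by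
      ext t; constructor
      · intro ht; exact ⟨t - u, ht, by simp⟩
      · rintro ⟨s, hs, rfl⟩; simpa using hs
    rw [this]
    have hl : LipschitzWith 1 (fun t : ℝ => t + u) := by
      apply LipschitzWith.of_dist_le_mul; intro x y; simp
    exact hl.isBounded_image hB
  · intro t
    rw [shift_apply u ζ (measurableSet_singleton t)]
    have : (fun s => s - u) ⁻¹' {t} = {t + u} := by
      ext s; simp only [mem_preimage, mem_singleton_iff]; constructor <;> intro h <;> linarith
    rw [this]; exact h.2 _

lemma GoodPP.Ioc_nat {ζ : Measure ℝ} (h : GoodPP ζ) (a b : ℝ) : ∃ n : ℕ, ζ (Ioc a b) = n :=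
  h.1 _ (Metric.isBounded_Ioc a b) measurableSet_Ioc

/-- integer-valued on unit cells -/
def CellPP : Set (Measure ℝ) := {ζ | ∀ n : ℤ, ∃ m : ℕ, ζ (Ioc (n : ℝ) (n + 1)) = m}

lemma GoodPP.cell {ζ : Measure ℝ} (h : GoodPP ζ) : ζ ∈ CellPP := fun n => h.Ioc_nat _ _

lemma measurableSet_cellPP : MeasurableSet CellPP := by
  have : CellPP = ⋂ n : ℤ, ⋃ m : ℕ, {ζ : Measure ℝ | ζ (Ioc (n : ℝ) (n + 1)) = m} := by
    ext ζ; simp [CellPP]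
  rw [this]
  refine MeasurableSet.iInter fun n => MeasurableSet.iUnion fun m => ?_
  exact (Measure.measurable_coe measurableSet_Ioc) (measurableSet_singleton _)

noncomputable def idKer : Kernel (Measure ℝ) ℝ := ⟨id, measurable_id⟩

lemma meas_cellset (n : ℤ) (m : ℕ) :
    MeasurableSet {ζ : Measure ℝ | ζ (Ioc (n : ℝ) (n + 1)) = m} :=
  (Measure.measurable_coe measurableSet_Ioc) (measurableSet_singleton _)

open Classical in
noncomputable def cellKer (p : ℤ × ℕ) : Kernel (Measure ℝ) ℝ :=
  Kernel.piecewise (meas_cellset p.1 p.2)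
    (idKer.restrict (measurableSet_Ioc (a := (p.1 : ℝ)) (b := p.1 + 1))) 0

instance (p : ℤ × ℕ) : IsFiniteKernel (cellKer p) := by
  refine ⟨⟨p.2, by simp, fun ζ => ?_⟩⟩
  unfold cellKer
  rw [Kernel.piecewise_apply]
  split_ifs with h
  · rw [Kernel.restrict_apply, Measure.restrict_apply_univ]
    exact le_of_eq h
  · simp

noncomputable def regKer : Kernel (Measure ℝ) ℝ := Kernel.sum cellKer

instance : IsSFiniteKernel regKer := by
  unfold regKer; exact Kernel.isSFiniteKernel_sum

lemma regKer_eq {ζ : Measure ℝ} (h : ζ ∈ CellPP) : regKer ζ = ζ := by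
  ext B hB
  unfold regKer
  rw [Kernel.sum_apply' _ _ hB, ENNReal.tsum_prod (f := fun n m => cellKer (n, m) ζ B)]
  have key : ∀ n : ℤ, ∑' m : ℕ, cellKer (n, m) ζ B = ζ (B ∩ Ioc (n : ℝ) (n + 1)) := by
    intro n
    obtain ⟨m, hm⟩ := h n
    rw [tsum_eq_single m]
    · unfold cellKer
      rw [Kernel.piecewise_apply, if_pos (by exact hm), Kernel.restrict_apply,
        Measure.restrict_apply hB]; rfl
    · intro m' hm'
      unfold cellKer
      rw [Kernel.piecewise_apply, if_neg]
      · simp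
      · intro h'
        have h' : ζ (Ioc (n : ℝ) (n + 1)) = m' := h'
        rw [hm] at h'
        exact hm' (by exact_mod_cast h'.symm)
  simp_rw [key]
  rw [← measure_iUnion]
  · rw [← inter_iUnion, iUnion_Ioc_intCast, inter_univ]
  · intro a b hab
    exact ((pairwise_disjoint_Ioc_intCast ℝ) hab).mono inter_subset_right inter_subset_right
  · intro n; exact hB.inter measurableSet_Ioc

lemma measurable_regKer_shift : Measurable (fun p : Measure ℝ × ℝ => shift p.2 (regKer p.1)) := by
  refine Measure.measurable_of_measurable_coe _ fun B hB => ?_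
  simp_rw [shift_apply _ _ hB]
  have h := Kernel.measurable_kernel_prodMk_left (κ := regKer.comap (Prod.fst : Measure ℝ × ℝ → _) measurable_fst)
    (t := {q : (Measure ℝ × ℝ) × ℝ | q.2 - q.1.2 ∈ B}) (by
      exact (show Measurable (fun q : (Measure ℝ × ℝ) × ℝ => q.2 - q.1.2) by fun_prop) hB)
  exact h

lemma measurable_regKer_Ioc :
    Measurable (fun p : (Measure ℝ × ℝ) × ℝ => regKer p.1.1 (Ioc p.1.2 p.2)) := by
  have h := Kernel.measurable_kernel_prodMk_left
    (κ := regKer.comap (fun p : (Measure ℝ × ℝ) × ℝ => p.1.1) (by fun_prop))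
    (t := {q : ((Measure ℝ × ℝ) × ℝ) × ℝ | q.1.1.2 < q.2 ∧ q.2 ≤ q.1.2}) (by
      have h1 : MeasurableSet {q : ((Measure ℝ × ℝ) × ℝ) × ℝ | q.1.1.2 < q.2} :=
        measurableSet_lt (by fun_prop) (by fun_prop)
      have h2 : MeasurableSet {q : ((Measure ℝ × ℝ) × ℝ) × ℝ | q.2 ≤ q.1.2} :=
        measurableSet_le (by fun_prop) (by fun_prop)
      exact h1.inter h2)
  exact h

lemma tau_lt_iff (j : ℕ) (hj : 1 ≤ j) (ζ : Measure ℝ) (c : ℝ≥0∞) :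
    tau j ζ < c ↔ ∃ q : ℚ, 0 < (q : ℝ) ∧ ENNReal.ofReal q < c ∧ (j : ℝ≥0∞) ≤ ζ (Ioc 0 (q : ℝ)) := by
  unfold tau
  rw [if_neg (by omega), sInf_lt_iff]
  constructor
  · rintro ⟨_, ⟨s, ⟨hs, hsj⟩, rfl⟩, hc⟩
    obtain ⟨r, hr1, hr2⟩ := ENNReal.lt_iff_exists_nnreal_btwn.1 hc
    have hsr : s < (r : ℝ) := (ENNReal.ofReal_lt_coe_iff hs.le).1 hr1
    obtain ⟨q, hq1, hq2⟩ := exists_rat_btwn hsr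
    refine ⟨q, hs.trans hq1, lt_trans ?_ hr2, hsj.trans (measure_mono (Ioc_subset_Ioc_right hq1.le))⟩
    exact (ENNReal.ofReal_lt_coe_iff (hs.trans hq1).le).2 hq2
  · rintro ⟨q, h0, hc, hq⟩
    exact ⟨_, ⟨q, ⟨h0, hq⟩, rfl⟩, hc⟩

lemma measurable_tau (j : ℕ) (hj : 1 ≤ j) : Measurable (tau j) := by
  refine measurable_of_Iio fun c => ?_
  have : tau j ⁻¹' Iio c = ⋃ q : ℚ, {ζ : Measure ℝ | 0 < (q : ℝ) ∧ ENNReal.ofReal q < c ∧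
      (j : ℝ≥0∞) ≤ ζ (Ioc 0 (q : ℝ))} := by
    ext ζ; simp only [mem_preimage, mem_Iio, mem_iUnion, mem_ofPred_eq]; exact tau_lt_iff j hj ζ c
  rw [this]
  refine MeasurableSet.iUnion fun q => ?_
  refine (MeasurableSet.const _).inter ((MeasurableSet.const _).inter ?_)
  exact measurableSet_le measurable_const (Measure.measurable_coe measurableSet_Ioc)

/-- facts about a finite `tau`. -/
lemma tau_facts (j : ℕ) (hj : 1 ≤ j) {η : Measure ℝ} (h : GoodPP η) (ht : tau j η ≠ ⊤) :
    0 < (tau j η).toReal ∧ η (Ioc 0 (tau j η).toReal) = j ∧ η {(tau j η).toReal} = 1 ∧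
      ∀ s : ℝ, 0 < s → (j : ℝ≥0∞) ≤ η (Ioc 0 s) → (tau j η).toReal ≤ s := by
  set t := (tau j η).toReal with htdef
  have hfin : ∀ a b, η (Ioc a b) ≠ ⊤ := fun a b => by
    obtain ⟨n, hn⟩ := h.Ioc_nat a b; rw [hn]; simp
  have ht0 : 0 ≤ t := ENNReal.toReal_nonneg
  have hle : ∀ s : ℝ, 0 < s → (j : ℝ≥0∞) ≤ η (Ioc 0 s) → t ≤ s := by
    intro s hs hsj
    apply ENNReal.toReal_le_of_le_ofReal hs.le
    unfold tau
    rw [if_neg (by omega)]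
    exact sInf_le ⟨s, ⟨hs, hsj⟩, rfl⟩
  have hgt : ∀ s : ℝ, t < s → (j : ℝ≥0∞) ≤ η (Ioc 0 s) := by
    intro s hs
    have : tau j η < ENNReal.ofReal s := (ENNReal.lt_ofReal_iff_toReal_lt ht).2 hs
    obtain ⟨q, hq0, hqc, hq⟩ := (tau_lt_iff j hj η _).1 this
    have := (ENNReal.ofReal_lt_ofReal_iff (ht0.trans_lt hs)).1 hqc
    exact hq.trans (measure_mono (Ioc_subset_Ioc_right this.le))
  obtain ⟨w, hwanti, hwt, hwlim⟩ := exists_seq_strictAnti_tendsto t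
  have hge : (j : ℝ≥0∞) ≤ η (Ioc 0 t) := by
    have hI : Ioc 0 t = ⋂ n, Ioc 0 (w n) := by
      ext x; simp only [mem_Ioc, mem_iInter]; constructor
      · rintro ⟨h1, h2⟩ n; exact ⟨h1, h2.trans (hwt n).le⟩
      · intro hx; exact ⟨(hx 0).1, ge_of_tendsto' hwlim fun n => (hx n).2⟩
    have := tendsto_measure_iInter_atTop (μ := η) (s := fun n => Ioc 0 (w n))
      (fun n => measurableSet_Ioc.nullMeasurableSet)
      (fun a b hab => Ioc_subset_Ioc_right (hwanti.antitone hab)) ⟨0, hfin _ _⟩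
    rw [hI]
    exact ge_of_tendsto' this fun n => hgt _ (hwt n)
  have htpos : 0 < t := by
    rcases ht0.lt_or_eq with h0 | h0
    · exact h0
    · rw [← h0] at hge; simp at hge; omega
  have hlt : η (Ioo 0 t) ≤ (j - 1 : ℕ) := by
    obtain ⟨w, hwm, hwt, hwlim⟩ := exists_seq_strictMono_tendsto t
    have hU : Ioo 0 t = ⋃ n, Ioc 0 (w n) := by
      ext x; simp only [mem_Ioo, mem_iUnion, mem_Ioc]; constructor
      · rintro ⟨h1, h2⟩
        obtain ⟨n, hn⟩ := (hwlim.eventually (lt_mem_nhds h2)).exists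
        exact ⟨n, h1, hn.le⟩
      · rintro ⟨n, h1, h2⟩; exact ⟨h1, h2.trans_lt (hwt n)⟩
    have := tendsto_measure_iUnion_atTop (μ := η) (s := fun n => Ioc 0 (w n))
      (fun a b hab => Ioc_subset_Ioc_right (hwm.monotone hab))
    rw [hU]
    refine le_of_tendsto' this fun n => ?_
    obtain ⟨m, hm⟩ := h.Ioc_nat 0 (w n)
    change η (Ioc 0 (w n)) ≤ _
    rw [hm]
    rcases le_or_gt (w n) 0 with h0 | h0
    · rw [Ioc_eq_empty (by linarith)] at hm; rw [← hm]; simp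
    · have : ¬ (j : ℝ≥0∞) ≤ m := fun hc => by
        rw [← hm] at hc; exact absurd (hle _ h0 hc) (not_le.2 (hwt n))
      have : m < j := by
        by_contra hc; push Not at hc; exact this (by exact_mod_cast hc)
      exact_mod_cast (by omega : m ≤ j - 1)
  have hsplit : η (Ioc 0 t) = η (Ioo 0 t) + η {t} := by
    rw [← Ioo_union_right htpos, measure_union (by simp) (measurableSet_singleton t)]
  obtain ⟨a, ha⟩ := h.1 (Ioo 0 t) (Metric.isBounded_Ioo _ _) measurableSet_Ioo
  obtain ⟨b, hb⟩ := h.1 {t} Bornology.isBounded_singleton (measurableSet_singleton t)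
  have hb1 := h.2 t
  rw [hsplit, ha, hb] at hge
  rw [ha] at hlt
  rw [hb] at hb1
  have e1 : j ≤ a + b := by exact_mod_cast hge
  have e2 : a ≤ j - 1 := by exact_mod_cast hlt
  have e3 : b ≤ 1 := by exact_mod_cast hb1
  refine ⟨htpos, ?_, ?_, hle⟩
  · rw [hsplit, ha, hb]; exact_mod_cast (by omega : a + b = j)
  · rw [hb]; exact_mod_cast (by omega : b = 1)

/-- A set with no mass between its points is null apart from its minimum. -/
lemma null_of_flat (ζ : Measure ℝ) (S : Set ℝ)
    (hS : ∀ a ∈ S, ∀ b ∈ S, a < b → ζ (Ioc a b) = 0) :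
    ζ {x | x ∈ S ∧ ∃ a ∈ S, a < x} = 0 := by
  refine measure_null_of_locally_null _ ?_
  rintro x ⟨hx, a, ha, hax⟩
  by_cases hb : ∃ b ∈ S, x < b
  · obtain ⟨b, hb, hxb⟩ := hb
    exact ⟨Ioc a b, mem_nhdsWithin_of_mem_nhds (Ioc_mem_nhds hax hxb), hS a ha b hb (hax.trans hxb)⟩
  · push Not at hb
    refine ⟨Ioc a x, ?_, hS a ha x hx hax⟩
    filter_upwards [mem_nhdsWithin_of_mem_nhds (Ioi_mem_nhds hax), self_mem_nhdsWithin] with y hy hyS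
    exact ⟨hy, hb y hyS.1⟩

lemma measure_le_one_of_flat (ζ : Measure ℝ) (h1 : ∀ t : ℝ, ζ {t} ≤ 1) (S : Set ℝ)
    (hS : ∀ a ∈ S, ∀ b ∈ S, a < b → ζ (Ioc a b) = 0) : ζ S ≤ 1 := by
  have h0 := null_of_flat ζ S hS
  by_cases hm : ∃ m ∈ S, ∀ x ∈ S, m ≤ x
  · obtain ⟨m, hm, hmin⟩ := hm
    have : S ⊆ {m} ∪ {x | x ∈ S ∧ ∃ a ∈ S, a < x} := by
      intro x hx
      rcases (hmin x hx).eq_or_lt with h | h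
      · left; exact h.symm
      · right; exact ⟨hx, m, hm, h⟩
    calc ζ S ≤ ζ {m} + _ := (measure_mono this).trans (measure_union_le _ _)
      _ ≤ 1 := by rw [h0, add_zero]; exact h1 m
  · push Not at hm
    have : S ⊆ {x | x ∈ S ∧ ∃ a ∈ S, a < x} := fun x hx => ⟨hx, hm x hx⟩
    rw [measure_mono_null this h0]; simp

lemma Ioc_add (ζ : Measure ℝ) {a b c : ℝ} (hab : a ≤ b) (hbc : b ≤ c) :
    ζ (Ioc a c) = ζ (Ioc a b) + ζ (Ioc b c) := by
  rw [← Ioc_union_Ioc_eq_Ioc hab hbc, measure_union (Ioc_disjoint_Ioc_of_le le_rfl)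
    measurableSet_Ioc]

lemma flat_right {ζ : Measure ℝ} {a b c : ℝ} {j : ℕ} (hab : a ≤ b) (hbc : b ≤ c)
    (hx : ζ (Ioc a b) = j) (hy : ζ (Ioc a c) = j) : ζ (Ioc b c) = 0 := by
  have h1 := Ioc_add ζ hab hbc
  rw [hy, hx] at h1
  by_contra h0
  exact absurd h1 (ENNReal.lt_add_right (by simp) h0).ne

lemma flat_left {ζ : Measure ℝ} {a b c : ℝ} {j : ℕ} (hab : a ≤ b) (hbc : b ≤ c)
    (hx : ζ (Ioc b c) = j) (hy : ζ (Ioc a c) = j) : ζ (Ioc a b) = 0 := by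
  have h1 := Ioc_add ζ hab hbc
  rw [hy, hx, add_comm] at h1
  by_contra h0
  exact absurd h1 (ENNReal.lt_add_right (by simp) h0).ne

/-- transport function: mass goes from `u` to the `j`-th next point `v`. -/
noncomputable def trK (j : ℕ) (f : Measure ℝ → ℝ≥0∞) (p : (Measure ℝ × ℝ) × ℝ) : ℝ≥0∞ :=
  indicator {p : (Measure ℝ × ℝ) × ℝ | p.1.2 < p.2 ∧ regKer p.1.1 (Ioc p.1.2 p.2) = j}
    (fun p => f (shift p.2 (regKer p.1.1))) p

lemma measurable_trK (j : ℕ) {f : Measure ℝ → ℝ≥0∞} (hf : Measurable f) :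
    Measurable (trK j f) := by
  unfold trK
  refine Measurable.indicator ?_ ?_
  · exact hf.comp (measurable_regKer_shift.comp
      (show Measurable (fun p : (Measure ℝ × ℝ) × ℝ => (p.1.1, p.2)) by fun_prop))
  · have h1 : MeasurableSet {p : (Measure ℝ × ℝ) × ℝ | p.1.2 < p.2} :=
      measurableSet_lt (by fun_prop) (by fun_prop)
    exact h1.inter (measurable_regKer_Ioc (measurableSet_singleton (j : ℝ≥0∞)))

lemma trK_eq (j : ℕ) (f : Measure ℝ → ℝ≥0∞) {ζ : Measure ℝ} (h : GoodPP ζ) (u v : ℝ) :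
    trK j f ((ζ, u), v) =
      indicator {v : ℝ | u < v ∧ ζ (Ioc u v) = j} (fun v => f (shift v ζ)) v := by
  classical
  simp only [trK, indicator_apply, mem_ofPred_eq, regKer_eq h.cell]

lemma trK_shift (j : ℕ) (f : Measure ℝ → ℝ≥0∞) {ζ : Measure ℝ} (h : GoodPP ζ) (w u v : ℝ) :
    trK j f ((shift w ζ, u), v) = trK j f ((ζ, u + w), v + w) := by
  classical
  rw [trK_eq j f h, trK_eq j f (h.shift w)]
  simp only [indicator_apply, mem_ofPred_eq, shift_Ioc, shift_shift, add_lt_add_iff_right]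

lemma lintegral_trK_right (j : ℕ) (hj : 1 ≤ j) {f : Measure ℝ → ℝ≥0∞} (hf : Measurable f)
    {ζ : Measure ℝ} (h : GoodPP ζ) (u : ℝ) (ht : tau j (shift u ζ) ≠ ⊤) :
    ∫⁻ v, trK j f ((ζ, u), v) ∂ζ = f (shift (tau j (shift u ζ)).toReal (shift u ζ)) := by
  obtain ⟨h1, h2, h3, h4⟩ := tau_facts j hj (h.shift u) ht
  set t := (tau j (shift u ζ)).toReal
  have hSm : MeasurableSet {v : ℝ | u < v ∧ ζ (Ioc u v) = j} := by
    have h1 : MeasurableSet {p : (Measure ℝ × ℝ) × ℝ | p.1.2 < p.2} :=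
      measurableSet_lt (by fun_prop) (by fun_prop)
    have h2 := h1.inter (measurable_regKer_Ioc (measurableSet_singleton (j : ℝ≥0∞)))
    have h3 := h2.preimage (measurable_prodMk_left (x := (ζ, u)))
    convert h3 using 1
    ext v
    simp [regKer_eq h.cell]
  simp_rw [trK_eq j f h]
  rw [lintegral_indicator hSm]
  rw [shift_Ioc, zero_add] at h2
  have h3' : ζ {t + u} = 1 := by
    rw [← h3, shift_apply u ζ (measurableSet_singleton t)]
    congr 1; ext s; simp only [mem_preimage, mem_singleton_iff]; constructor <;> intro h <;> linarith
  have hmin : ∀ v, u < v → ζ (Ioc u v) = j → t + u ≤ v := by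
    intro v huv hv
    have := h4 (v - u) (by linarith) (by rw [shift_Ioc]; simp [hv])
    linarith
  have hmem : t + u ∈ {v : ℝ | u < v ∧ ζ (Ioc u v) = j} := ⟨by linarith, h2⟩
  have hnull := null_of_flat ζ {v : ℝ | u < v ∧ ζ (Ioc u v) = j}
    (fun a ha b hb hab => flat_right ha.1.le hab.le ha.2 hb.2)
  have hae : ({v : ℝ | u < v ∧ ζ (Ioc u v) = j} : Set ℝ) =ᵐ[ζ] ({t + u} : Set ℝ) := by
    refine ae_eq_set.2 ⟨measure_mono_null ?_ hnull, ?_⟩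
    · rintro v ⟨hv, hne⟩
      exact ⟨hv, t + u, hmem, lt_of_le_of_ne (hmin v hv.1 hv.2) (Ne.symm hne)⟩
    · rw [sdiff_eq_empty.2 (singleton_subset_iff.2 hmem)]; simp
  rw [setLIntegral_congr hae, Measure.restrict_singleton, lintegral_smul_measure, h3',
    lintegral_dirac, shift_shift]
  simp

lemma lintegral_trK_left (j : ℕ) (f : Measure ℝ → ℝ≥0∞)
    {ζ : Measure ℝ} (h : GoodPP ζ) (v : ℝ) :
    ∫⁻ u, trK j f ((ζ, u), v) ∂ζ ≤ f (shift v ζ) := by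
  classical
  have : ∀ u, trK j f ((ζ, u), v) =
      indicator {u : ℝ | u < v ∧ ζ (Ioc u v) = j} (fun _ => f (shift v ζ)) u := by
    intro u
    rw [trK_eq j f h]
    simp only [indicator_apply, mem_ofPred_eq]
  simp_rw [this]
  refine (lintegral_indicator_const_le _ _).trans ?_
  have := measure_le_one_of_flat ζ h.2 {u : ℝ | u < v ∧ ζ (Ioc u v) = j}
    (fun a ha b hb hab => flat_left hab.le hb.1.le hb.2 ha.2)
  exact (mul_le_mul_right this _).trans (by simp)

/-- transported mass from `A` to `B`. -/
noncomputable def trMass (j : ℕ) (f : Measure ℝ → ℝ≥0∞) (A B : Set ℝ) (ζ : Measure ℝ) : ℝ≥0∞ :=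
  ∫⁻ u in A, ∫⁻ v in B, trK j f ((ζ, u), v) ∂(regKer ζ) ∂(regKer ζ)

lemma measurable_trMass (j : ℕ) {f : Measure ℝ → ℝ≥0∞} (hf : Measurable f) {A B : Set ℝ}
    (hA : MeasurableSet A) (hB : MeasurableSet B) : Measurable (trMass j f A B) := by
  unfold trMass
  have h1 : Measurable (fun p : Measure ℝ × ℝ => ∫⁻ v in B, trK j f (p, v) ∂(regKer p.1)) := by
    exact Measurable.setLIntegral_kernel_prod_right
      (κ := regKer.comap (Prod.fst : Measure ℝ × ℝ → _) measurable_fst)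
      (f := fun p v => trK j f (p, v)) (measurable_trK j hf) hB
  exact Measurable.setLIntegral_kernel_prod_right (κ := regKer)
    (f := fun ζ u => ∫⁻ v in B, trK j f ((ζ, u), v) ∂(regKer ζ)) h1 hA

lemma trMass_eq (j : ℕ) (f : Measure ℝ → ℝ≥0∞) (A B : Set ℝ) {ζ : Measure ℝ} (h : GoodPP ζ) :
    trMass j f A B ζ = ∫⁻ u in A, ∫⁻ v in B, trK j f ((ζ, u), v) ∂ζ ∂ζ := by
  unfold trMass; rw [regKer_eq h.cell]

lemma GoodPP.sfinite {ζ : Measure ℝ} (h : GoodPP ζ) : SFinite ζ := by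
  rw [← regKer_eq h.cell]; infer_instance

lemma trMass_shift (j : ℕ) {f : Measure ℝ → ℝ≥0∞} (hf : Measurable f) {A B : Set ℝ}
    (hA : MeasurableSet A) (hB : MeasurableSet B) {ζ : Measure ℝ} (h : GoodPP ζ) (w : ℝ) :
    trMass j f A B (shift w ζ) =
      trMass j f ((fun t => t - w) ⁻¹' A) ((fun t => t - w) ⁻¹' B) ζ := by
  rw [trMass_eq j f _ _ h, trMass_eq j f _ _ (h.shift w)]
  have := h.sfinite
  have hK : Measurable (fun p : ℝ × ℝ => trK j f ((ζ, p.1 + w), p.2 + w)) :=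
    (measurable_trK j hf).comp (by fun_prop)
  simp_rw [trK_shift j f h]
  have e : ∀ u, ∫⁻ v in B, trK j f ((ζ, u + w), v + w) ∂(shift w ζ) =
      ∫⁻ v in (fun t => t - w) ⁻¹' B, trK j f ((ζ, u + w), v) ∂ζ := by
    intro u
    rw [lintegral_shift w ζ (fun v => trK j f ((ζ, u + w), v + w))
      (hK.comp measurable_prodMk_left) hB]
    simp
  simp_rw [e]
  rw [lintegral_shift w ζ _ _ hA]
  · simp
  · have : Measurable (fun p : ℝ × ℝ => trK j f ((ζ, p.1 + w), p.2)) :=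
      (measurable_trK j hf).comp (by fun_prop)
    exact this.lintegral_prod_right'

lemma mass_transport (j : ℕ) {f : Measure ℝ → ℝ≥0∞} (hf : Measurable f)
    (P : Measure (Measure ℝ)) (hstat : IsStationaryPP P) (hg : ∀ᵐ ζ ∂P, GoodPP ζ) :
    ∫⁻ ζ, trMass j f (Ioc 0 1) univ ζ ∂P = ∫⁻ ζ, trMass j f univ (Ioc 0 1) ζ ∂P := by
  have hdec : ∀ n : ℤ, MeasurableSet (Ioc (n : ℝ) (n + 1)) := fun n => measurableSet_Ioc
  have hKm : ∀ ζ, Measurable (fun p : ℝ × ℝ => trK j f ((ζ, p.1), p.2)) := fun ζ =>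
    (measurable_trK j hf).comp (by fun_prop)
  have e1 : ∀ ζ, trMass j f (Ioc 0 1) univ ζ =
      ∑' n : ℤ, trMass j f (Ioc 0 1) (Ioc (n : ℝ) (n + 1)) ζ := by
    intro ζ
    unfold trMass
    rw [← lintegral_tsum]
    · refine lintegral_congr fun u => ?_
      rw [← lintegral_iUnion hdec (pairwise_disjoint_Ioc_intCast ℝ), iUnion_Ioc_intCast]
    · intro n
      exact (hKm ζ).lintegral_prod_right'.aemeasurable
  have e2 : ∀ ζ, trMass j f univ (Ioc 0 1) ζ =
      ∑' n : ℤ, trMass j f (Ioc (n : ℝ) (n + 1)) (Ioc 0 1) ζ := by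
    intro ζ
    unfold trMass
    rw [← lintegral_iUnion hdec (pairwise_disjoint_Ioc_intCast ℝ), iUnion_Ioc_intCast]
  simp_rw [e1, e2]
  rw [lintegral_tsum fun n => (measurable_trMass j hf measurableSet_Ioc (hdec n)).aemeasurable,
    lintegral_tsum fun n => (measurable_trMass j hf (hdec n) measurableSet_Ioc).aemeasurable]
  rw [← (Equiv.neg ℤ).tsum_eq]
  refine tsum_congr fun n => ?_
  have hs := hstat (-n : ℝ)
  conv_rhs => rw [← hs]
  rw [lintegral_map (measurable_trMass j hf (hdec n) measurableSet_Ioc) (measurable_shift _)]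
  refine lintegral_congr_ae ?_
  filter_upwards [hg] with ζ hζ
  rw [trMass_shift j hf (hdec n) measurableSet_Ioc hζ]
  congr 1
  · ext t; simp only [mem_preimage, mem_Ioc]; constructor <;> rintro ⟨h1, h2⟩ <;> constructor <;> linarith
  · ext t; simp only [mem_preimage, mem_Ioc, Equiv.neg_apply, Int.cast_neg]; constructor <;> rintro ⟨h1, h2⟩ <;> constructor <;> linarith

lemma trMass_le (j : ℕ) {f : Measure ℝ → ℝ≥0∞} (hf : Measurable f) {ζ : Measure ℝ}
    (h : GoodPP ζ) : trMass j f univ (Ioc 0 1) ζ ≤ ∫⁻ v in Ioc 0 1, f (shift v ζ) ∂ζ := by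
  rw [trMass_eq j f _ _ h]
  have := h.sfinite
  have hK : Measurable (fun p : ℝ × ℝ => trK j f ((ζ, p.1), p.2)) :=
    (measurable_trK j hf).comp (by fun_prop)
  rw [lintegral_lintegral_swap hK.aemeasurable, Measure.restrict_univ]
  exact lintegral_mono fun v => lintegral_trK_left j f h v

/-- No last point. -/
lemma no_last (P : Measure (Measure ℝ)) [IsProbabilityMeasure P] (hstat : IsStationaryPP P) :
    ∀ᵐ ζ ∂P, ∀ n : ℕ, ζ (Ioc (n : ℝ) (n + 1)) ≠ 0 → ζ (Ioi ((n : ℝ) + 1)) ≠ 0 := by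
  let L : ℕ → Set (Measure ℝ) := fun n =>
    {ζ | ζ (Ioc (n : ℝ) (n + 1)) ≠ 0 ∧ ζ (Ioi ((n : ℝ) + 1)) = 0}
  have hLm : ∀ n, MeasurableSet (L n) := fun n => by
    have h1 : MeasurableSet {ζ : Measure ℝ | ζ (Ioc (n : ℝ) (n + 1)) = 0} :=
      (Measure.measurable_coe measurableSet_Ioc) (measurableSet_singleton _)
    have h2 : MeasurableSet {ζ : Measure ℝ | ζ (Ioi ((n : ℝ) + 1)) = 0} :=
      (Measure.measurable_coe measurableSet_Ioi) (measurableSet_singleton _)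
    exact h1.compl.inter h2
  have hL : ∀ n, P (L n) = P (L 0) := by
    intro n
    conv_rhs => rw [← hstat n, Measure.map_apply (measurable_shift _) (hLm 0)]
    congr 1
    ext ζ
    simp only [L, mem_preimage, mem_ofPred_eq, shift_Ioc, shift_Ioi]
    simp [add_comm]
  have hd : Pairwise (Function.onFun Disjoint L) := by
    have key : ∀ m n : ℕ, m < n → Disjoint (L m) (L n) := by
      intro m n hmn
      rw [Set.disjoint_left]
      rintro ζ h1 h2
      refine h2.1 (measure_mono_null ?_ h1.2)
      have : (m : ℝ) + 1 ≤ n := by exact_mod_cast hmn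
      exact fun x hx => lt_of_le_of_lt this hx.1
    intro m n hmn
    rcases lt_or_gt_of_ne hmn with h | h
    · exact key m n h
    · exact (key n m h).symm
  have h0 : P (L 0) = 0 := by
    by_contra hne
    have h1 := measure_iUnion hd hLm (μ := P)
    simp_rw [hL] at h1
    rw [ENNReal.tsum_const_eq_top_of_ne_zero hne] at h1
    exact measure_ne_top P _ h1
  rw [ae_all_iff]
  intro n
  have : P (L n) = 0 := (hL n).trans h0
  filter_upwards [measure_eq_zero_iff_ae_notMem.1 this] with ζ hζ h1 h2
  exact hζ ⟨h1, h2⟩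

lemma tau_ne_top (j : ℕ) (hj : 1 ≤ j) {ζ : Measure ℝ} (h : GoodPP ζ)
    (hl : ∀ n : ℕ, ζ (Ioc (n : ℝ) (n + 1)) ≠ 0 → ζ (Ioi ((n : ℝ) + 1)) ≠ 0)
    (h0 : ζ (Ioc 0 1) ≠ 0) (u : ℝ) : tau j (shift u ζ) ≠ ⊤ := by
  have hn : ∀ n : ℕ, ζ (Ioi (n : ℝ)) ≠ 0 := by
    intro n
    induction n with
    | zero => exact fun hc => h0 (measure_mono_null (by intro x hx; simpa using hx.1) hc)
    | succ n ih =>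
      push_cast
      by_cases hc : ζ (Ioc (n : ℝ) (n + 1)) = 0
      · intro hc2
        apply ih
        rw [← Ioc_union_Ioi_eq_Ioi (show (n : ℝ) ≤ n + 1 by linarith)]
        exact measure_union_null hc hc2
      · exact hl n hc
  have hstep : ∀ x : ℝ, ∃ y, x < y ∧ 1 ≤ ζ (Ioc x y) := by
    intro x
    by_contra! hc
    have hz : ∀ y, x < y → ζ (Ioc x y) = 0 := by
      intro y hy
      obtain ⟨m, hm⟩ := h.Ioc_nat x y
      have := hc y hy
      rw [hm] at this ⊢
      have : m < 1 := by exact_mod_cast this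
      have : m = 0 := by omega
      simp [this]
    obtain ⟨n, hxn⟩ := exists_nat_ge x
    apply hn n
    have : Ioi (n : ℝ) ⊆ ⋃ k : ℕ, Ioc x (x + (k + 1 : ℕ)) := by
      intro z hz
      obtain ⟨k, hk⟩ := exists_nat_ge (z - x)
      refine mem_iUnion.2 ⟨k, lt_of_le_of_lt hxn hz, ?_⟩
      push_cast; linarith
    refine measure_mono_null this (measure_iUnion_null fun k => hz _ ?_)
    have : (0 : ℝ) < (k + 1 : ℕ) := by positivity
    linarith
  have hj' : ∀ i : ℕ, ∃ s : ℝ, 0 < s ∧ (i : ℝ≥0∞) ≤ ζ (Ioc u (u + s)) := by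
    intro i
    induction i with
    | zero => exact ⟨1, one_pos, by simp⟩
    | succ i ih =>
      obtain ⟨s, hs, hi⟩ := ih
      obtain ⟨y, hy, h1⟩ := hstep (u + s)
      refine ⟨y - u, by linarith, ?_⟩
      rw [show u + (y - u) = y by ring, Ioc_add ζ (show u ≤ u + s by linarith) hy.le]
      push_cast
      exact add_le_add hi h1
  obtain ⟨s, hs, hi⟩ := hj' j
  have : tau j (shift u ζ) ≤ ENNReal.ofReal s := by
    unfold tau
    rw [if_neg (by omega)]
    refine sInf_le ⟨s, ⟨hs, ?_⟩, rfl⟩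
    rw [shift_Ioc, zero_add, add_comm s]; exact hi
  exact ne_top_of_le_ne_top ENNReal.ofReal_ne_top this

/-- Cycle-stationarity of the Palm distribution: for every `j ≥ 1`, `Q`-a.s. `τ_j(η) < ∞`,
and the pushforward of `Q` under `η ↦ θ^{τ_j(η)} η` equals `Q`. -/
theorem palm_cycle_stationary
    (P Q : Measure (Measure ℝ)) [IsProbabilityMeasure P] [IsProbabilityMeasure Q]
    (hstat : IsStationaryPP P) (hsimple : IsSimplePP P)
    (hI0 : intensity P ≠ 0) (hItop : intensity P ≠ ⊤)
    (hQ : IsPalm P Q) (j : ℕ) (hj : 1 ≤ j) :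
    (∀ᵐ η ∂Q, tau j η ≠ ⊤) ∧
      Measure.map (fun η => shift (tau j η).toReal η) Q = Q := by
  have hg : ∀ᵐ ζ ∂P, GoodPP ζ := hsimple
  have hl := no_last P hstat
  -- a measurable property which holds at all points of a.e. configuration holds `Q`-a.s.
  have transfer : ∀ B : Set (Measure ℝ), MeasurableSet B →
      (∀ᵐ ζ ∂P, ∀ u, ζ (Ioc 0 1) ≠ 0 → shift u ζ ∉ B) → ∀ᵐ η ∂Q, η ∉ B := by
    intro B hB h
    rw [← measure_eq_zero_iff_ae_notMem, ← lintegral_indicator_one hB,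
      hQ _ (measurable_one.indicator hB)]
    have : ∫⁻ ζ, (∫⁻ u in Ioc (0 : ℝ) 1, B.indicator 1 (shift u ζ) ∂ζ) ∂P = ∫⁻ ζ, 0 ∂P := by
      refine lintegral_congr_ae ?_
      filter_upwards [h] with ζ hζ
      by_cases h0 : ζ (Ioc 0 1) = 0
      · exact setLIntegral_measure_zero _ _ h0
      · have : ∀ u, B.indicator (1 : Measure ℝ → ℝ≥0∞) (shift u ζ) = 0 := fun u =>
          indicator_of_notMem (hζ u h0) _
        simp [this]
    rw [this]; simp
  have hcellQ : ∀ᵐ η ∂Q, η ∈ CellPP := by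
    have := transfer CellPPᶜ measurableSet_cellPP.compl (by
      filter_upwards [hg] with ζ hζ u _ hc
      exact hc (hζ.shift u).cell)
    filter_upwards [this] with η h
    exact not_not.1 h
  have hfin : ∀ᵐ η ∂Q, tau j η ≠ ⊤ :=
    transfer {η | tau j η = ⊤} (measurable_tau j hj (measurableSet_singleton _)) (by
      filter_upwards [hg, hl] with ζ hζ hlζ u h0
      exact tau_ne_top j hj hζ hlζ h0 u)
  refine ⟨hfin, ?_⟩
  have hTm : Measurable (fun η : Measure ℝ => shift (tau j η).toReal (regKer η)) :=
    measurable_regKer_shift.comp (measurable_id.prodMk (measurable_tau j hj).ennreal_toReal)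
  have hTae : (fun η => shift (tau j η).toReal η) =ᵐ[Q]
      (fun η : Measure ℝ => shift (tau j η).toReal (regKer η)) := by
    filter_upwards [hcellQ] with η h
    simp only [regKer_eq h]
  rw [Measure.map_congr hTae]
  have : IsProbabilityMeasure (Measure.map (fun η : Measure ℝ => shift (tau j η).toReal (regKer η)) Q) :=
    Measure.isProbabilityMeasure_map hTm.aemeasurable
  refine Measure.eq_of_le_of_isProbabilityMeasure ?_
  refine Measure.le_iff.2 fun B hB => ?_
  let f : Measure ℝ → ℝ≥0∞ := B.indicator 1
  have hf : Measurable f := measurable_one.indicator hB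
  rw [← lintegral_indicator_one hB, ← lintegral_indicator_one hB]
  change ∫⁻ η, f η ∂_ ≤ ∫⁻ η, f η ∂Q
  rw [lintegral_map hf hTm,
    hQ (fun η => f (shift (tau j η).toReal (regKer η))) (hf.comp hTm), hQ f hf]
  refine mul_le_mul_right ?_ _
  calc ∫⁻ ζ, (∫⁻ u in Ioc (0 : ℝ) 1,
          f (shift (tau j (shift u ζ)).toReal (regKer (shift u ζ))) ∂ζ) ∂P
      = ∫⁻ ζ, trMass j f (Ioc 0 1) univ ζ ∂P := by
        refine lintegral_congr_ae ?_
        filter_upwards [hg, hl] with ζ hζ hlζ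
        rw [trMass_eq j f _ _ hζ]
        by_cases h0 : ζ (Ioc 0 1) = 0
        · rw [setLIntegral_measure_zero _ _ h0, setLIntegral_measure_zero _ _ h0]
        · refine lintegral_congr fun u => ?_
          rw [Measure.restrict_univ, lintegral_trK_right j hj hf hζ u (tau_ne_top j hj hζ hlζ h0 u),
            regKer_eq (hζ.shift u).cell]
    _ = ∫⁻ ζ, trMass j f univ (Ioc 0 1) ζ ∂P := mass_transport j hf P hstat hg
    _ ≤ _ := by
        refine lintegral_mono_ae ?_
        filter_upwards [hg] with ζ hζ
        exact trMass_le j hf hζ
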